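/- For every m, n ≥ 3 and l ≥ −1, the chromatic symmetric function of the dumbbell graph satisfies X_{D(m,l,n)} = (m−1)(n−1)·X_{P_{m+l+n}} − (m−1)·Σ_{i=2}^{n−1} X_{P_{m+l+n−i}}·X_{C_i} − (n−1)·Σ_{j=2}^{m−1} X_{P_{m+l+n−j}}·X_{C_j} + Σ_{i=2}^{n−1} Σ_{j=2}^{m−1} X_{P_{m+l+n−i−j}}·X_{C_i}·X_{C_j}, where in the sums the cycle C_2 is identified with the path P_2. -/

import Mathlib

noncomputable section

open SimpleGraph

/-- The chromatic symmetric function of a finite simple graph, as a formal power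
series in countably many commuting variables `x_0, x_1, x_2, …`: the coefficient of the
monomial `∏ i, x_i ^ d i` is the number of proper colourings `κ : V → ℕ` in which colour `i`
is used exactly `d i` times. -/
def csf {V : Type} [Fintype V] (G : SimpleGraph V) : MvPowerSeries ℕ ℚ :=
  fun d => (Nat.card {κ : V → ℕ //
      (∀ u v : V, G.Adj u v → κ u ≠ κ v) ∧
      ∀ i : ℕ, Nat.card {v : V // κ v = i} = d i} : ℚ)

/-- The elementary symmetric function `e_k` as a formal power series. -/
def esym (k : ℕ) : MvPowerSeries ℕ ℚ :=
  fun d => if (∀ i ∈ d.support, d i = 1) ∧ (d.sum fun _ v => v) = k then 1 else 0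

/-- `e_λ` for a partition `λ` given as a multiset of parts. -/
def esymM (μ : Multiset ℕ) : MvPowerSeries ℕ ℚ :=
  (μ.map esym).prod

/-- A symmetric function is `e`-positive if it is a finite nonnegative linear combination
of the elementary symmetric functions `e_λ`, `λ` a partition (all parts positive). -/
def EPositive (f : MvPowerSeries ℕ ℚ) : Prop :=
  ∃ c : Multiset ℕ →₀ ℚ, (∀ μ, 0 ≤ c μ) ∧ (∀ μ ∈ c.support, 0 ∉ μ) ∧
    f = c.sum fun μ a => a • esymM μ

/-- The path `P_k` on `k` vertices. -/
def pathG (k : ℕ) : SimpleGraph (Fin k) :=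
  SimpleGraph.fromRel (fun i j => (j : ℕ) = (i : ℕ) + 1)

/-- The cycle `C_m` on `m` vertices (for `m = 2` this is a single edge, i.e. `P_2`). -/
def cycleG (m : ℕ) : SimpleGraph (Fin m) :=
  SimpleGraph.fromRel (fun i j => (j : ℕ) = ((i : ℕ) + 1) % m)

/-- Auxiliary relation for sun graphs: body relation on `Fin n`, plus rays
`P_{lam i}` attached at vertex `i`, the leaf `⟨i,0⟩` of ray `i` being joined to `i`. -/
def sunRel (n : ℕ) (lam : Fin n → ℕ) (body : Fin n → Fin n → Prop) :
    (Fin n ⊕ ((i : Fin n) × Fin (lam i))) → (Fin n ⊕ ((i : Fin n) × Fin (lam i))) → Prop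
  | Sum.inl i, Sum.inl i' => body i i'
  | Sum.inl i, Sum.inr p => p.1 = i ∧ (p.2 : ℕ) = 0
  | Sum.inr p, Sum.inr q => p.1 = q.1 ∧ (q.2 : ℕ) = (p.2 : ℕ) + 1
  | _, _ => False

/-- The sun graph `S(n; λ_1, …, λ_n)`: a cycle `C_n` with a path `P_{λ_i}` (a *ray*)
joined by an edge to the `i`-th cycle vertex, for each `i`. -/
def sunGraph (n : ℕ) (lam : Fin n → ℕ) :
    SimpleGraph (Fin n ⊕ ((i : Fin n) × Fin (lam i))) :=
  SimpleGraph.fromRel (sunRel n lam (fun i i' => (i' : ℕ) = ((i : ℕ) + 1) % n))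

/-- The complete sun graph `S̄(n; λ_1, …, λ_n)`: as `sunGraph`, but with complete body `K_n`. -/
def completeSunGraph (n : ℕ) (lam : Fin n → ℕ) :
    SimpleGraph (Fin n ⊕ ((i : Fin n) × Fin (lam i))) :=
  SimpleGraph.fromRel (sunRel n lam (fun i i' => i ≠ i'))

/-- The spider `S(μ_1, …, μ_d)`: `d` paths (legs) `P_{μ_i}`, each joined at a leaf to a
common centre vertex. -/
def spiderGraph (d : ℕ) (mu : Fin d → ℕ) :
    SimpleGraph (Unit ⊕ ((i : Fin d) × Fin (mu i))) :=
  SimpleGraph.fromRel (fun a b => match a, b with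
    | Sum.inl _, Sum.inr p => (p.2 : ℕ) = 0
    | Sum.inr p, Sum.inr q => p.1 = q.1 ∧ (q.2 : ℕ) = (p.2 : ℕ) + 1
    | _, _ => False)

/-- The graph obtained from a body graph `H` on `Fin n` by joining each body vertex `i`
by an edge to a chosen vertex `u i` of a graph `Gs i`. -/
def attachGraph {n : ℕ} {Vs : Fin n → Type} (H : SimpleGraph (Fin n))
    (Gs : ∀ i, SimpleGraph (Vs i)) (u : ∀ i, Vs i) :
    SimpleGraph (Fin n ⊕ ((i : Fin n) × Vs i)) :=
  SimpleGraph.fromRel (fun a b => match a, b with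
    | Sum.inl i, Sum.inl i' => H.Adj i i'
    | Sum.inl i, Sum.inr p => p.1 = i ∧ p.2 = u p.1
    | Sum.inr p, Sum.inr q => ∃ h : p.1 = q.1, (Gs q.1).Adj (h ▸ p.2) q.2
    | _, _ => False)

/-- `G` has a connected partition of type `μ`: a partition of the vertex set all of whose
blocks induce connected subgraphs, the multiset of block sizes being `μ`. -/
def HasConnectedPartition {V : Type} [Fintype V] [DecidableEq V]
    (G : SimpleGraph V) (μ : Multiset ℕ) : Prop :=
  ∃ P : Finpartition (Finset.univ : Finset V),
    (∀ p ∈ P.parts, (G.induce (↑p : Set V)).Connected) ∧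
      P.parts.val.map Finset.card = μ

/-- `G` has a perfect matching: a partition of `V(G)` into pairs of adjacent vertices. -/
def HasPerfectMatching {V : Type} (G : SimpleGraph V) : Prop :=
  ∃ M : G.Subgraph, M.IsPerfectMatching

/-- `G` has an almost perfect matching: a partition of `V(G)` into pairs of adjacent
vertices together with one singleton. -/
def HasAlmostPerfectMatching {V : Type} (G : SimpleGraph V) : Prop :=
  ∃ M : G.Subgraph, M.IsMatching ∧ ∃ v : V, M.verts = {v}ᶜ

/-- The tadpole graph `T_{m,l}`: the cycle `C_m` (vertices `0, …, m-1`, consecutive edges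
plus the chord `{0, m-1}`) with a path on `l` further vertices attached by an edge at
vertex `m-1`.  For `l = 0` this is just `C_m`. -/
def tadpole (m l : ℕ) : SimpleGraph (Fin (m + l)) :=
  SimpleGraph.fromRel (fun i j =>
    (j : ℕ) = (i : ℕ) + 1 ∨ ((i : ℕ) = 0 ∧ (j : ℕ) = m - 1))

/-- Dumbbell with path-parameter `t = l + 1 ≥ 0`: vertices `0, …, m-1` form the cycle `C_m`
(consecutive edges plus chord `{0, m-1}`), vertices `m+t-1, …, m+n+t-2` form the cycle `C_n`
(consecutive edges plus chord `{m+t-1, m+n+t-2}`), and the vertices in between form the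
connecting path; for `t = 0` (i.e. `l = -1`) the two cycles share the vertex `m-1`. -/
def dumbbellAux (m n t : ℕ) : SimpleGraph (Fin (m + n + t - 1)) :=
  SimpleGraph.fromRel (fun i j =>
    (j : ℕ) = (i : ℕ) + 1
      ∨ ((i : ℕ) = 0 ∧ (j : ℕ) = m - 1)
      ∨ ((i : ℕ) = m + t - 1 ∧ (j : ℕ) = m + n + t - 2))

/-- The dumbbell graph `D(m, l, n)` for `l ≥ -1`: cycles `C_m` and `C_n` joined by a path
on `l` vertices (for `l = 1` a single joining vertex, for `l = 0` a joining edge, and for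
`l = -1` the two cycles share a vertex). -/
def dumbbell (m n : ℕ) (l : ℤ) : SimpleGraph (Fin (m + n + (l + 1).toNat - 1)) :=
  dumbbellAux m n (l + 1).toNat

end

/-- The generating function of the proper colourings of `G` with colours in `C`, where the
colour `c` has weight `x c`. -/
noncomputable def colourSum {V C R : Type} [Fintype V] [DecidableEq V] [Fintype C] [CommRing R]
    (x : C → R) (G : SimpleGraph V) : R :=
  open Classical in
  ∑ κ : V → C, if ∀ u v, G.Adj u v → κ u ≠ κ v then ∏ v, x (κ v) else 0

/-- The power series with no monomial in the variables `x_0, …, x_{N-1}` alone. -/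
def higherVariablesIdeal (N : ℕ) : Ideal (MvPowerSeries ℕ ℚ) where
  carrier := {f | ∀ d : ℕ →₀ ℕ, (∀ i ∈ d.support, i < N) → MvPowerSeries.coeff d f = 0}
  zero_mem' := fun d _ => by simp
  add_mem' := fun {f g} hf hg d hd => by simp [hf d hd, hg d hd]
  smul_mem' := fun f g hg d hd => by
    classical
    rw [smul_eq_mul, MvPowerSeries.coeff_mul]
    refine Finset.sum_eq_zero fun p hp => ?_
    rw [hg p.2, mul_zero]
    intro i hi
    refine hd i ?_
    rw [Finset.HasAntidiagonal.mem_antidiagonal] at hp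
    rw [← hp]
    simp only [Finsupp.mem_support_iff, Finsupp.add_apply] at hi ⊢
    omega

theorem prod_X_eq_monomial {V : Type} [Fintype V] (κ : V → ℕ) :
    ∏ v, (MvPowerSeries.X (κ v) : MvPowerSeries ℕ ℚ) =
      MvPowerSeries.monomial (∑ v, Finsupp.single (κ v) 1) 1 := by
  classical
  induction (Finset.univ : Finset V) using Finset.induction_on with
  | empty => simp
  | insert a s ha ih =>
    rw [Finset.prod_insert ha, Finset.sum_insert ha, ih, MvPowerSeries.X,
      MvPowerSeries.monomial_mul_monomial, one_mul]

theorem eq_sum_single_iff {V : Type} [Fintype V] (κ : V → ℕ) (d : ℕ →₀ ℕ) :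
    d = ∑ v, Finsupp.single (κ v) 1 ↔ ∀ i, Nat.card {v : V // κ v = i} = d i := by
  classical
  rw [Finsupp.ext_iff]
  refine forall_congr' fun i => ?_
  rw [Finsupp.finsetSum_apply, Nat.card_eq_fintype_card, Fintype.card_subtype,
    Finset.card_filter]
  simp only [Finsupp.single_apply]
  exact eq_comm

theorem csf_sub_colourSum_mem {V : Type} [Fintype V] [DecidableEq V] (G : SimpleGraph V) (N : ℕ) :
    csf G - colourSum (fun c : Fin N => (MvPowerSeries.X (c : ℕ) : MvPowerSeries ℕ ℚ)) G ∈
      higherVariablesIdeal N := by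
  classical
  intro d hd
  rw [map_sub, sub_eq_zero]
  have hsum : MvPowerSeries.coeff d
      (colourSum (fun c : Fin N => (MvPowerSeries.X (c : ℕ) : MvPowerSeries ℕ ℚ)) G) =
      (Nat.card {κ : V → Fin N // (∀ u v : V, G.Adj u v → κ u ≠ κ v) ∧
        ∀ i : ℕ, Nat.card {v : V // (κ v : ℕ) = i} = d i} : ℚ) := by
    rw [colourSum, map_sum, Nat.card_eq_fintype_card, Fintype.card_subtype,
      Finset.card_filter, Nat.cast_sum]
    refine Finset.sum_congr rfl fun κ _ => ?_
    by_cases h : ∀ u v, G.Adj u v → κ u ≠ κ v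
    · rw [if_pos h, prod_X_eq_monomial (fun v => (κ v : ℕ)), MvPowerSeries.coeff_monomial]
      rw [Nat.cast_ite, Nat.cast_one, Nat.cast_zero]
      exact if_congr ((eq_sum_single_iff _ _).trans (and_iff_right h).symm) rfl rfl
    · rw [if_neg h, if_neg (fun h' => h h'.1), map_zero, Nat.cast_zero]
  rw [hsum]
  change (Nat.card _ : ℚ) = _
  congr 1
  symm
  refine Nat.card_eq_of_bijective
    (fun κ => ⟨fun v => (κ.1 v : ℕ), fun u v huv h => κ.2.1 u v huv (Fin.ext h), κ.2.2⟩)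
    ⟨fun κ κ' h => ?_, fun κ => ?_⟩
  · ext v
    exact congrFun (congrArg Subtype.val h) v
  · have hlt : ∀ v, κ.1 v < N := fun v => hd _ <| by
      rw [Finsupp.mem_support_iff, ← κ.2.2 (κ.1 v)]
      have : Nonempty {w : V // κ.1 w = κ.1 v} := ⟨⟨v, rfl⟩⟩
      exact Nat.card_pos.ne'
    exact ⟨⟨fun v => ⟨κ.1 v, hlt v⟩, fun u v huv h => κ.2.1 u v huv (Fin.ext_iff.1 h), κ.2.2⟩,
      rfl⟩

theorem forall_fromRel_adj_ne_iff {V C : Type} (r : V → V → Prop) (κ : V → C) :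
    (∀ u v, (SimpleGraph.fromRel r).Adj u v → κ u ≠ κ v) ↔
      ∀ u v, u ≠ v → r u v → κ u ≠ κ v := by
  simp only [SimpleGraph.fromRel_adj]
  constructor
  · exact fun h u v huv hr => h u v ⟨huv, Or.inl hr⟩
  · rintro h u v ⟨huv, hr | hr⟩
    · exact h u v huv hr
    · exact (h v u huv.symm hr).symm

theorem path_proper_iff {C : Type} {k : ℕ} (κ : Fin (k + 1) → C) :
    (∀ u v, (pathG (k + 1)).Adj u v → κ u ≠ κ v) ↔
      ∀ i : Fin k, κ i.castSucc ≠ κ i.succ := by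
  rw [pathG, forall_fromRel_adj_ne_iff]
  constructor
  · exact fun h i => h _ _ (by simp [Fin.ext_iff]) (by simp)
  · intro h u v _ huv
    have hu : (u : ℕ) < k := by omega
    have := h ⟨u, hu⟩
    rwa [show (⟨u, hu⟩ : Fin k).succ = v from Fin.ext huv.symm] at this

theorem cycle_proper_iff {C : Type} {k : ℕ} (hk : 1 ≤ k) (κ : Fin (k + 1) → C) :
    (∀ u v, (cycleG (k + 1)).Adj u v → κ u ≠ κ v) ↔
      (∀ i : Fin k, κ i.castSucc ≠ κ i.succ) ∧ κ 0 ≠ κ (Fin.last k) := by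
  rw [← path_proper_iff, cycleG, pathG, forall_fromRel_adj_ne_iff, forall_fromRel_adj_ne_iff]
  constructor
  · refine fun h => ⟨fun u v huv huv' => h u v huv ?_, (h _ _ ?_ ?_).symm⟩
    · rw [Nat.mod_eq_of_lt] <;> omega
    · simp only [ne_eq, Fin.ext_iff, Fin.val_last, Fin.val_zero]
      omega
    · simp
  · rintro ⟨h, h0⟩ u v huv huv'
    by_cases hu : (u : ℕ) + 1 < k + 1
    · exact h u v huv (by rwa [Nat.mod_eq_of_lt hu] at huv')
    · have hu' : u = Fin.last k := Fin.ext (by simp; omega)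
      have hv : v = 0 := Fin.ext (by rw [huv', hu']; simp)
      rw [hu', hv]
      exact h0.symm

theorem dumbbell_proper_iff {C : Type} {m n t : ℕ} (hm : 1 ≤ m) (hn : 1 ≤ n)
    (κ : Fin (m + t + n + 1) → C) :
    (∀ u v, (SimpleGraph.fromRel (fun i j : Fin (m + t + n + 1) =>
      (j : ℕ) = (i : ℕ) + 1 ∨ ((i : ℕ) = 0 ∧ (j : ℕ) = m)
        ∨ ((i : ℕ) = m + t ∧ (j : ℕ) = m + t + n))).Adj u v → κ u ≠ κ v) ↔
      (∀ i : Fin (m + t + n), κ i.castSucc ≠ κ i.succ) ∧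
        κ 0 ≠ κ ⟨m, by omega⟩ ∧ κ ⟨m + t, by omega⟩ ≠ κ (Fin.last _) := by
  rw [← path_proper_iff, pathG, forall_fromRel_adj_ne_iff, forall_fromRel_adj_ne_iff]
  constructor
  · refine fun h => ⟨fun u v huv huv' => h u v huv (Or.inl huv'), h _ _ ?_ ?_, h _ _ ?_ ?_⟩
    · simp only [ne_eq, Fin.ext_iff, Fin.val_zero]
      omega
    · simp
    · simp only [ne_eq, Fin.ext_iff, Fin.val_last]
      omega
    · simp
  · rintro ⟨h, h1, h2⟩ u v huv (huv' | ⟨hu, hv⟩ | ⟨hu, hv⟩)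
    · exact h u v huv huv'
    · rwa [show u = 0 from Fin.ext hu, show v = ⟨m, by omega⟩ from Fin.ext hv]
    · have hu' : κ u = κ ⟨m + t, by omega⟩ := congrArg κ (Fin.ext hu)
      have hv' : κ v = κ (Fin.last _) := congrArg κ (Fin.ext hv)
      rwa [hu', hv']

section Transfer

open Finset Matrix

variable {C R : Type} [DecidableEq C] [CommRing R] (x : C → R)

/-- The transfer matrix of proper colourings of a path. -/
def transfer : Matrix C C R := fun a b => if a ≠ b then x b else 0

/-- The number of vertices is `k + 1`; the weight of the first vertex is omitted. -/
def walkWeight {k : ℕ} (κ : Fin (k + 1) → C) : R :=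
  ∏ i : Fin k, transfer x (κ i.castSucc) (κ i.succ)

theorem mul_walkWeight {k : ℕ} (κ : Fin (k + 1) → C) :
    x (κ 0) * walkWeight x κ =
      if ∀ i : Fin k, κ i.castSucc ≠ κ i.succ then ∏ v, x (κ v) else 0 := by
  simp only [walkWeight, transfer, Finset.prod_ite_zero, Finset.mem_univ, true_imp_iff,
    mul_ite, mul_zero, Fin.prod_univ_succ (fun v => x (κ v))]

variable [Fintype C]

/-- Summing out the last `q` vertices of a walk, apart from the very last one. -/
theorem sum_walkWeight_mul (p q : ℕ) (F : (Fin (p + 1) → C) → C → R) :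
    ∑ κ : Fin (p + q + 1) → C, walkWeight x κ *
        F (fun i => κ (Fin.castLE (by omega) i)) (κ (Fin.last _)) =
      ∑ κ : Fin (p + 1) → C, walkWeight x κ *
        ∑ e, (transfer x ^ q) (κ (Fin.last p)) e * F κ e := by
  induction q generalizing F with
  | zero =>
    refine Finset.sum_congr rfl fun κ _ => ?_
    simp [Matrix.one_apply]
  | succ q ih =>
    refine ((Fin.snocEquiv (fun _ : Fin (p + q + 1 + 1) => C)).sum_comp _).symm.trans ?_
    rw [Fintype.sum_prod_type]
    have hstep : ∀ (e : C) (κ : Fin (p + q + 1) → C),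
        walkWeight x (Fin.snocEquiv (fun _ : Fin (p + q + 1 + 1) => C) (e, κ)) *
          F (fun i => Fin.snocEquiv (fun _ : Fin (p + q + 1 + 1) => C) (e, κ)
            (Fin.castLE (by omega) i))
            (Fin.snocEquiv (fun _ : Fin (p + q + 1 + 1) => C) (e, κ) (Fin.last _)) =
        walkWeight x κ * ((fun κ₁ f => transfer x f e * F κ₁ e)
          (fun i => κ (Fin.castLE (by omega) i)) (κ (Fin.last _))) := by
      intro e κ
      have h1 : (fun i : Fin (p + 1) => (Fin.snoc κ e : Fin (p + q + 1 + 1) → C)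
          (Fin.castLE (by omega) i)) = fun i => κ (Fin.castLE (by omega) i) := by
        funext i
        exact Fin.snoc_castSucc (α := fun _ => C) e κ (Fin.castLE (by omega) i)
      simp only [Fin.snocEquiv_apply, Fin.snoc_last, walkWeight]
      rw [Fin.prod_univ_castSucc, h1]
      simp only [Fin.snoc_castSucc, Fin.succ_last, Fin.snoc_last, ← Fin.castSucc_succ]
      ring
    refine (Finset.sum_congr rfl fun e _ => (Finset.sum_congr rfl fun κ _ => hstep e κ).trans
      (ih fun κ₁ f => transfer x f e * F κ₁ e)).trans ?_
    rw [Finset.sum_comm]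
    refine Finset.sum_congr rfl fun κ _ => ?_
    rw [← Finset.mul_sum]
    congr 1
    refine Finset.sum_congr rfl fun e _ => ?_
    rw [pow_succ, Matrix.mul_apply, Finset.sum_mul]
    exact Finset.sum_congr rfl fun f _ => (mul_assoc _ _ _).symm

theorem sum_walkWeight_mul_ends (k : ℕ) (F : C → C → R) :
    ∑ κ : Fin (k + 1) → C, walkWeight x κ * F (κ 0) (κ (Fin.last k)) =
      ∑ a, ∑ e, (transfer x ^ k) a e * F a e := by
  have key := sum_walkWeight_mul x 0 k (fun κ e => F (κ 0) e)
  replace key := key.trans ((Equiv.funUnique (Fin 1) C).symm.sum_comp _).symm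
  obtain rfl | hk := Nat.eq_zero_or_pos k
  · simpa [walkWeight] using key
  · have h : ∀ j (_ : j = 0 + k), ∑ κ : Fin (j + 1) → C, walkWeight x κ *
        F (κ 0) (κ (Fin.last _)) = ∑ a, ∑ e, (transfer x ^ k) a e * F a e := by
      rintro j rfl
      refine key.trans ?_
      simp [walkWeight]
    exact h k (Nat.zero_add k).symm

theorem colourSum_pathG (k : ℕ) :
    colourSum x (pathG (k + 1)) = ∑ a, x a * (transfer x ^ k *ᵥ 1) a := by
  have h := sum_walkWeight_mul_ends x k (fun a _ => x a)
  simp only [colourSum, path_proper_iff, mulVec, dotProduct, Finset.mul_sum]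
  simp only [mul_comm _ (x _), mul_walkWeight] at h
  convert h using 4
  simp

theorem colourSum_cycleG (k : ℕ) (hk : 1 ≤ k) :
    colourSum x (cycleG (k + 1)) = (transfer x ^ (k + 1)).trace := by
  have h := sum_walkWeight_mul_ends x k (fun a e => if e ≠ a then x a else 0)
  simp only [colourSum, cycle_proper_iff hk, trace, diag_apply, pow_succ, mul_apply]
  refine Eq.trans (Finset.sum_congr rfl fun κ _ => ?_) h
  rw [mul_ite, mul_zero, mul_comm, mul_walkWeight, ← ite_and]
  refine if_congr ?_ rfl rfl
  rw [and_comm, ne_comm]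

theorem trace_transfer : (transfer x).trace = 0 := by simp [trace, transfer]

/-- The weight of the colourings of a cycle on `k + 1` vertices, with the colour of one vertex
prescribed and its weight omitted. -/
def rootedCycle (k : ℕ) (c : C) : R := ∑ e, if c ≠ e then (transfer x ^ k) c e else 0

theorem transfer_pow_succ_diag (k : ℕ) (c : C) :
    (transfer x ^ (k + 1)) c c = x c * rootedCycle x k c := by
  rw [pow_succ, mul_apply, rootedCycle, Finset.mul_sum]
  refine Finset.sum_congr rfl fun e _ => ?_
  rw [transfer]
  by_cases h : e = c
  · simp [h]
  · rw [if_pos h, if_pos (Ne.symm h), mul_comm]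

theorem trace_transfer_pow_succ (k : ℕ) :
    (transfer x ^ (k + 1)).trace = ∑ c, x c * rootedCycle x k c := by
  simp only [trace, diag_apply, transfer_pow_succ_diag]

theorem colourSum_dumbbell (m n t k : ℕ) (hm : 1 ≤ m) (hn : 1 ≤ n) (hk : k = m + t + n + 1) :
    colourSum x (SimpleGraph.fromRel (fun i j : Fin k =>
      (j : ℕ) = (i : ℕ) + 1 ∨ ((i : ℕ) = 0 ∧ (j : ℕ) = m)
        ∨ ((i : ℕ) = m + t ∧ (j : ℕ) = m + t + n))) =
      ∑ b, x b * (rootedCycle x m b * (transfer x ^ t *ᵥ rootedCycle x n) b) := by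
  subst hk
  have h1 := sum_walkWeight_mul x (m + t) n (fun κ e =>
    (if κ 0 ≠ κ ⟨m, by omega⟩ then x (κ 0) else 0) * if κ (Fin.last _) ≠ e then 1 else 0)
  have h2 := sum_walkWeight_mul x m t (fun κ c =>
    (if κ 0 ≠ κ (Fin.last _) then x (κ 0) else 0) * rootedCycle x n c)
  have h3 := sum_walkWeight_mul_ends x m (fun a b =>
    (if b ≠ a then x a else 0) * (transfer x ^ t *ᵥ rootedCycle x n) b)
  calc _ = _ := ?_
    _ = _ := h1
    _ = _ := ?_
    _ = _ := h2
    _ = _ := ?_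
    _ = _ := h3
    _ = _ := ?_
  · rw [colourSum]
    refine Finset.sum_congr rfl fun κ _ => ?_
    have hw := mul_walkWeight x κ
    simp only [dumbbell_proper_iff hm hn]
    change _ = _ * ((if κ 0 ≠ κ ⟨m, by omega⟩ then x (κ 0) else 0) *
      if κ ⟨m + t, by omega⟩ ≠ κ (Fin.last _) then 1 else 0)
    by_cases ha : κ 0 ≠ κ ⟨m, by omega⟩ <;>
      by_cases hb : κ ⟨m + t, by omega⟩ ≠ κ (Fin.last _)
    · simp only [ha, hb, and_true, ne_eq, not_false_eq_true, if_true, mul_one, mul_comm _ (x _), hw]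
    all_goals simp [ha, hb]
  · refine Finset.sum_congr rfl fun κ _ => ?_
    congr 1
    change _ = (if κ 0 ≠ κ ⟨m, by omega⟩ then x (κ 0) else 0) * _
    rw [rootedCycle, Finset.mul_sum]
    refine Finset.sum_congr rfl fun e _ => ?_
    split_ifs <;> ring
  · refine Finset.sum_congr rfl fun κ _ => ?_
    congr 1
    simp only [mulVec, dotProduct, Finset.mul_sum]
    refine Finset.sum_congr rfl fun e _ => ?_
    simp only [ne_comm (a := κ 0)]
    ring
  · rw [Finset.sum_comm]
    refine Finset.sum_congr rfl fun b _ => ?_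
    rw [← mul_assoc, ← transfer_pow_succ_diag, pow_succ', mul_apply, Finset.sum_mul]
    refine Finset.sum_congr rfl fun a _ => ?_
    rw [transfer]
    ring

theorem rootedCycle_succ (k : ℕ) :
    rootedCycle x (k + 1) =
      transfer x ^ (k + 1) *ᵥ 1 + transfer x *ᵥ rootedCycle x k
        - fun _ => (transfer x ^ (k + 1)).trace := by
  funext c
  have h1 : ∀ (k : ℕ) (c : C), rootedCycle x k c =
      (transfer x ^ k *ᵥ 1) c - (transfer x ^ k) c c := by
    intro k c
    rw [rootedCycle, eq_sub_iff_add_eq, mulVec, dotProduct,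
      ← Finset.add_sum_erase _ _ (Finset.mem_univ c),
      ← Finset.add_sum_erase _ (fun e => (transfer x ^ k) c e * _) (Finset.mem_univ c)]
    have : ∀ e ∈ univ.erase c, (if c ≠ e then (transfer x ^ k) c e else 0) =
        (transfer x ^ k) c e := fun e he => if_pos (Finset.ne_of_mem_erase he).symm
    rw [Finset.sum_congr rfl this]
    simp [add_comm]
  have h2 : (transfer x *ᵥ rootedCycle x k) c =
      (transfer x ^ (k + 1)).trace - x c * rootedCycle x k c := by
    rw [trace_transfer_pow_succ, eq_sub_iff_add_eq, mulVec, dotProduct,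
      ← Finset.add_sum_erase _ _ (Finset.mem_univ c),
      ← Finset.add_sum_erase _ (fun e => x e * _) (Finset.mem_univ c)]
    have : ∀ e ∈ univ.erase c, transfer x c e * rootedCycle x k e = x e * rootedCycle x k e :=
      fun e he => by rw [transfer, if_pos (Finset.ne_of_mem_erase he).symm]
    rw [Finset.sum_congr rfl this]
    simp [transfer, add_comm]
  rw [Pi.sub_apply, Pi.add_apply, h1, h2, transfer_pow_succ_diag]
  ring

theorem rootedCycle_zero : rootedCycle x 0 = 0 := by
  funext c
  refine Finset.sum_eq_zero fun e _ => ?_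
  split_ifs with h
  · simp [h]
  · rfl

theorem rootedCycle_eq (k : ℕ) :
    rootedCycle x k = (k : R) • (transfer x ^ k *ᵥ 1)
      - ∑ i ∈ Icc 2 k, (transfer x ^ i).trace • (transfer x ^ (k - i) *ᵥ 1) := by
  induction k with
  | zero => simp [rootedCycle_zero]
  | succ k ih =>
    obtain rfl | hk := Nat.eq_zero_or_pos k
    · rw [rootedCycle_succ, rootedCycle_zero]
      ext c
      simp [trace_transfer]
    · rw [rootedCycle_succ, ih, Finset.sum_Icc_succ_top (by omega), mulVec_sub, mulVec_smul,
        mulVec_mulVec, ← pow_succ', mulVec_sum]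
      have : ∀ i ∈ Icc 2 k, transfer x *ᵥ (transfer x ^ i).trace • (transfer x ^ (k - i) *ᵥ 1) =
          (transfer x ^ i).trace • (transfer x ^ (k + 1 - i) *ᵥ 1) := by
        intro i hi
        rw [Finset.mem_Icc] at hi
        rw [mulVec_smul, mulVec_mulVec, ← pow_succ', Nat.sub_add_comm hi.2]
      rw [Finset.sum_congr rfl this]
      ext c
      simp
      ring

theorem sum_mul_transfer_pow (k : ℕ) (u w : C → R) :
    ∑ b, x b * ((transfer x ^ k *ᵥ u) b * w b) = ∑ b, x b * (u b * (transfer x ^ k *ᵥ w) b) := by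
  induction k generalizing u w with
  | zero => simp
  | succ k ih =>
    rw [pow_succ, ← mulVec_mulVec, ih, ← pow_succ, pow_succ', ← mulVec_mulVec]
    generalize transfer x ^ k *ᵥ w = z
    simp only [mulVec, dotProduct, Finset.mul_sum, Finset.sum_mul]
    rw [Finset.sum_comm]
    refine Finset.sum_congr rfl fun a _ => Finset.sum_congr rfl fun b _ => ?_
    simp only [transfer]
    by_cases h : a = b
    · simp [h]
    · rw [if_pos h, if_pos (Ne.symm h)]
      ring

theorem sum_path_mul_path (i j t : ℕ) :
    ∑ b, x b * ((transfer x ^ i *ᵥ 1) b * (transfer x ^ t *ᵥ (transfer x ^ j *ᵥ 1)) b) =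
      colourSum x (pathG (i + t + j + 1)) := by
  rw [sum_mul_transfer_pow, colourSum_pathG]
  simp only [mulVec_mulVec, ← pow_add, Pi.one_apply, one_mul, ← add_assoc]

theorem colourSum_dumbbell_expansion (m n t : ℕ) :
    ∑ b, x b * (rootedCycle x m b * (transfer x ^ t *ᵥ rootedCycle x n) b) =
      (m : R) * n * colourSum x (pathG (m + t + n + 1))
        - m * ∑ i ∈ Icc 2 n, colourSum x (pathG (m + t + (n - i) + 1)) * colourSum x (cycleG i)
        - n * ∑ j ∈ Icc 2 m, colourSum x (pathG (m - j + t + n + 1)) * colourSum x (cycleG j)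
        + ∑ i ∈ Icc 2 n, ∑ j ∈ Icc 2 m, colourSum x (pathG (m - j + t + (n - i) + 1)) *
            colourSum x (cycleG i) * colourSum x (cycleG j) := by
  have hC : ∀ (k : ℕ) (f : ℕ → R), ∑ i ∈ Icc 2 k, f i * colourSum x (cycleG i) =
      ∑ i ∈ Icc 2 k, (transfer x ^ i).trace * f i := by
    refine fun k f => Finset.sum_congr rfl fun i hi => ?_
    rw [Finset.mem_Icc] at hi
    obtain ⟨i, rfl⟩ : ∃ i', i = i' + 1 := ⟨i - 1, by omega⟩
    rw [colourSum_cycleG x i (by omega), mul_comm]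
  let L : (C → R) →ₗ[R] (C → R) →ₗ[R] R :=
    LinearMap.mk₂ R (fun u w => ∑ b, x b * (u b * (transfer x ^ t *ᵥ w) b))
      (fun u u' w => by simp only [Pi.add_apply, add_mul, mul_add, Finset.sum_add_distrib])
      (fun c u w => by
        simp only [Pi.smul_apply, smul_eq_mul, Finset.mul_sum]
        exact Finset.sum_congr rfl fun b _ => by ring)
      (fun u w w' => by
        simp only [mulVec_add, Pi.add_apply, mul_add, Finset.sum_add_distrib])
      (fun c u w => by
        simp only [mulVec_smul, Pi.smul_apply, smul_eq_mul, Finset.mul_sum]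
        exact Finset.sum_congr rfl fun b _ => by ring)
  have hL : ∀ i j, L (transfer x ^ i *ᵥ 1) (transfer x ^ j *ᵥ 1) =
      colourSum x (pathG (i + t + j + 1)) := fun i j => sum_path_mul_path x i j t
  change L (rootedCycle x m) (rootedCycle x n) = _
  rw [rootedCycle_eq, rootedCycle_eq]
  simp only [map_sub, map_sum, map_smul, LinearMap.sub_apply, LinearMap.sum_apply,
    LinearMap.smul_apply, hL, smul_eq_mul]
  have hCC : ∀ f : ℕ → ℕ → R,
      ∑ i ∈ Icc 2 n, ∑ j ∈ Icc 2 m, f i j * colourSum x (cycleG i) * colourSum x (cycleG j) =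
      ∑ i ∈ Icc 2 n, (transfer x ^ i).trace * ∑ j ∈ Icc 2 m, (transfer x ^ j).trace * f i j := by
    intro f
    rw [← hC n]
    refine Finset.sum_congr rfl fun i _ => ?_
    rw [hC m, Finset.sum_mul]
    exact Finset.sum_congr rfl fun j _ => by ring
  have hm : ∀ f : ℕ → R, ∑ i ∈ Icc 2 n, (transfer x ^ i).trace * ((m : R) * f i) =
      m * ∑ i ∈ Icc 2 n, (transfer x ^ i).trace * f i := by
    intro f
    rw [Finset.mul_sum]
    exact Finset.sum_congr rfl fun i _ => by ring
  rw [hCC, hC n, hC m]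
  simp only [mul_sub, Finset.sum_sub_distrib, hm]
  ring

end Transfer

theorem csf_dumbbellAux_expansion (m n t : ℕ) (hm : 1 ≤ m) (hn : 1 ≤ n) :
    csf (dumbbellAux (m + 1) (n + 1) t) =
      (m : MvPowerSeries ℕ ℚ) * n * csf (pathG (m + t + n + 1))
        - m * ∑ i ∈ Finset.Icc 2 n, csf (pathG (m + t + (n - i) + 1)) * csf (cycleG i)
        - n * ∑ j ∈ Finset.Icc 2 m, csf (pathG (m - j + t + n + 1)) * csf (cycleG j)
        + ∑ i ∈ Finset.Icc 2 n, ∑ j ∈ Finset.Icc 2 m,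
            csf (pathG (m - j + t + (n - i) + 1)) * csf (cycleG i) * csf (cycleG j) := by
  ext d
  obtain ⟨N, hN⟩ : ∃ N, ∀ i ∈ d.support, i < N :=
    ⟨d.support.sup id + 1, fun i hi => Nat.lt_succ_of_le (Finset.le_sup (f := id) hi)⟩
  rw [← sub_eq_zero, ← map_sub]
  refine (Ideal.Quotient.eq (I := higherVariablesIdeal N)).1 ?_ d hN
  have hcsf {k : ℕ} (G : SimpleGraph (Fin k)) :
      Ideal.Quotient.mk (higherVariablesIdeal N) (csf G) =
      Ideal.Quotient.mk (higherVariablesIdeal N)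
        (colourSum (fun c : Fin N => (MvPowerSeries.X (c : ℕ) : MvPowerSeries ℕ ℚ)) G) :=
    Ideal.Quotient.eq.2 (csf_sub_colourSum_mem G N)
  have hD : dumbbellAux (m + 1) (n + 1) t = SimpleGraph.fromRel (fun i j : Fin _ =>
      (j : ℕ) = (i : ℕ) + 1 ∨ ((i : ℕ) = 0 ∧ (j : ℕ) = m)
        ∨ ((i : ℕ) = m + t ∧ (j : ℕ) = m + t + n)) := by
    unfold dumbbellAux
    congr! 6 <;> omega
  simp only [map_add, map_sub, map_mul, map_sum, hcsf]
  rw [hD, colourSum_dumbbell _ m n t _ hm hn (by omega), colourSum_dumbbell_expansion]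
  simp only [map_add, map_sub, map_mul, map_sum]

/-- For `m, n ≥ 3` and `l ≥ -1`:
`X_{D(m,l,n)} = (m-1)(n-1)·X_{P_{m+l+n}} - (m-1)·Σ_{i=2}^{n-1} X_{P_{m+l+n-i}}·X_{C_i}
 - (n-1)·Σ_{j=2}^{m-1} X_{P_{m+l+n-j}}·X_{C_j}
 + Σ_{i=2}^{n-1} Σ_{j=2}^{m-1} X_{P_{m+l+n-i-j}}·X_{C_i}·X_{C_j}`,
where `C_2` is identified with `P_2` (as it is in the definition of `cycleG`). -/
theorem dumbbell_path_cycle_expansion (m n : ℕ) (l : ℤ) (hm : 3 ≤ m) (hn : 3 ≤ n)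
    (hl : -1 ≤ l) :
    csf (dumbbell m n l) =
      (((m - 1) * (n - 1) : ℕ) : MvPowerSeries ℕ ℚ) *
          csf (pathG ((m : ℤ) + l + n).toNat)
        - ((m - 1 : ℕ) : MvPowerSeries ℕ ℚ) *
            ∑ i ∈ Finset.Icc 2 (n - 1),
              csf (pathG ((m : ℤ) + l + n - i).toNat) * csf (cycleG i)
        - ((n - 1 : ℕ) : MvPowerSeries ℕ ℚ) *
            ∑ j ∈ Finset.Icc 2 (m - 1),
              csf (pathG ((m : ℤ) + l + n - j).toNat) * csf (cycleG j)
        + ∑ i ∈ Finset.Icc 2 (n - 1), ∑ j ∈ Finset.Icc 2 (m - 1),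
            csf (pathG ((m : ℤ) + l + n - i - j).toNat) * csf (cycleG i) * csf (cycleG j) := by
  obtain ⟨m, rfl⟩ : ∃ m', m = m' + 1 := ⟨m - 1, by omega⟩
  obtain ⟨n, rfl⟩ : ∃ n', n = n' + 1 := ⟨n - 1, by omega⟩
  rw [dumbbell, csf_dumbbellAux_expansion m n _ (by omega) (by omega)]
  simp only [Nat.add_sub_cancel, Nat.cast_mul]
  have h₀ : ((m + 1 : ℕ) + l + (n + 1 : ℕ) : ℤ).toNat = m + (l + 1).toNat + n + 1 := by omega
  have hi : ∀ i ∈ Finset.Icc 2 n, ((m + 1 : ℕ) + l + (n + 1 : ℕ) - i : ℤ).toNat =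
      m + (l + 1).toNat + (n - i) + 1 := by
    intro i hi
    rw [Finset.mem_Icc] at hi
    omega
  have hj : ∀ j ∈ Finset.Icc 2 m, ((m + 1 : ℕ) + l + (n + 1 : ℕ) - j : ℤ).toNat =
      m - j + (l + 1).toNat + n + 1 := by
    intro j hj
    rw [Finset.mem_Icc] at hj
    omega
  have hij : ∀ i ∈ Finset.Icc 2 n, ∀ j ∈ Finset.Icc 2 m,
      ((m + 1 : ℕ) + l + (n + 1 : ℕ) - i - j : ℤ).toNat =
        m - j + (l + 1).toNat + (n - i) + 1 := by
    intro i hi j hj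
    rw [Finset.mem_Icc] at hi hj
    omega
  rw [h₀]
  refine congrArg₂ _ (congrArg₂ _ (congrArg _ (congrArg _ ?_)) (congrArg _ ?_)) ?_
  · exact Finset.sum_congr rfl fun i h => by rw [hi i h]
  · exact Finset.sum_congr rfl fun j h => by rw [hj j h]
  · exact Finset.sum_congr rfl fun i h => Finset.sum_congr rfl fun j h' => by rw [hij i h j h']
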